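/- arXiv:1902.08557 — 2 statements merged into one kernel-verified Lean document; each statement's English description precedes it below -/
import Mathlib

section
/- Assume p is odd, n is odd, n is a multiple of t/r, and suppose λ ∈ 𝔽_q^* satisfies λ = δ^{[n]} for some δ ∈ 𝔽_q^*. Then every skew λ-constacyclic code of length n over 𝔽_q (with respect to θ_r) is equivalent to a skew negacyclic code: the Hamming-weight-preserving 𝔽_q-linear bijection ψ_{−δ} maps the set of skew λ-constacyclic codes of length n bijectively onto the set of skew negacyclic codes of length n (this uses that [n] is odd, so (−δ)^{[n]} = −λ). -/
open scoped BigOperators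

/-- The ring `R = 𝔽_q + v 𝔽_q`, `v² = v`, realized concretely as `F × F`
via the `F`-algebra isomorphism `a + v b ↦ (a, a + b)`. -/
abbrev Rg (F : Type) := F × F

/-- The element `v` of `R`: under the identification above, `v = (0, 1)`. -/
def vv (F : Type) [Field F] : Rg F := (0, 1)

/-- The element `v • x + (1 - v) • y` of `Rⁿ`, for `x, y ∈ Fⁿ`. -/
def mix {F : Type} [Field F] {n : ℕ} (x y : Fin n → F) : Fin n → Rg F :=
  fun i => vv F * algebraMap F (Rg F) (x i) + (1 - vv F) * algebraMap F (Rg F) (y i)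

/-- `v A ⊕ (1 - v) B = {v a + (1-v) b : a ∈ A, b ∈ B}`. -/
def mixSet {F : Type} [Field F] {n : ℕ} (A B : Set (Fin n → F)) : Set (Fin n → Rg F) :=
  {c | ∃ x ∈ A, ∃ y ∈ B, c = mix x y}

/-- Euclidean dual (of an arbitrary subset). -/
def dualE {K : Type} [CommRing K] {n : ℕ} (C : Set (Fin n → K)) : Set (Fin n → K) :=
  {x | ∀ y ∈ C, ∑ i, x i * y i = 0}

/-- Hermitian dual w.r.t. a conjugation map. -/
def dualH {K : Type} [CommRing K] (conj : K → K) {n : ℕ} (C : Set (Fin n → K)) :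
    Set (Fin n → K) :=
  {x | ∀ y ∈ C, ∑ i, x i * conj (y i) = 0}

/-- The map `a + v b ↦ a ^ e + v * b ^ e` on `R` (i.e. the extension of `x ↦ x ^ e`
from `F` to `R`); used for `θ_r` (`e = p ^ r`) and for conjugation (`e = p ^ (t/2)`). -/
def thR (F : Type) [Field F] (e : ℕ) : Rg F → Rg F :=
  fun z => (z.1 ^ e, z.1 ^ e + (z.2 - z.1) ^ e)

/-- The skew `λ`-constacyclic shift
`(c₀, …, c_{n-1}) ↦ (λ θ(c_{n-1}), θ(c₀), …, θ(c_{n-2}))`. -/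
def skewShift {K : Type} [Mul K] (th : K → K) (lam : K) {n : ℕ} (c : Fin n → K) :
    Fin n → K :=
  fun i =>
    if (i : ℕ) = 0 then
      lam * th (c ⟨n - 1, Nat.sub_lt (Nat.lt_of_le_of_lt (Nat.zero_le _) i.isLt) Nat.one_pos⟩)
    else th (c ⟨(i : ℕ) - 1, Nat.lt_of_le_of_lt (Nat.sub_le _ _) i.isLt⟩)

/-- A set of words is skew `λ`-constacyclic if it is stable under the skew shift. -/
def SkewConsta {K : Type} [Mul K] (th : K → K) (lam : K) {n : ℕ}
    (C : Set (Fin n → K)) : Prop :=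
  ∀ c ∈ C, skewShift th lam c ∈ C

/-- `[i] = (p^{ri} - 1)/(p^r - 1) = 1 + p^r + ⋯ + p^{r(i-1)}` (so `[0] = 0`). -/
def brk (p r i : ℕ) : ℕ := ∑ j ∈ Finset.range i, p ^ (r * j)

/-- The monomial map `ψ_δ : (c₀, …, c_{n-1}) ↦ (δ^{[0]} c₀, …, δ^{[n-1]} c_{n-1})`. -/
def psi {K : Type} [Monoid K] (p r : ℕ) (δ : K) {n : ℕ} (c : Fin n → K) : Fin n → K :=
  fun i => δ ^ brk p r (i : ℕ) * c i

/-- A set is a linear code over `K` if it is (the carrier of) a `K`-submodule. -/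
def IsLinCode (K : Type) [Semiring K] {M : Type} [AddCommMonoid M] [Module K M]
    (S : Set M) : Prop :=
  ∃ C : Submodule K M, ↑C = S

/-- The Gray map `Φ(a + v b) = (a, a + b)`, componentwise; under the identification
`R = F × F` it is the canonical unzip `Rⁿ ≅ Fⁿ × Fⁿ`. -/
def gray {F : Type} [Field F] {n : ℕ} (c : Fin n → Rg F) : (Fin n → F) × (Fin n → F) :=
  (fun i => (c i).1, fun i => (c i).2)

/-- Euclidean dual in `F^{2n} ≅ Fⁿ × Fⁿ` w.r.t. the standard inner product. -/
def dualProd {F : Type} [Field F] {n : ℕ} (S : Set ((Fin n → F) × (Fin n → F))) :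
    Set ((Fin n → F) × (Fin n → F)) :=
  {x | ∀ y ∈ S, (∑ i, x.1 i * y.1 i) + (∑ i, x.2 i * y.2 i) = 0}

theorem brk_succ (p r i : ℕ) : brk p r (i + 1) = p ^ r * brk p r i + 1 := by
  simp only [brk, Finset.sum_range_succ', Finset.sum_mul, mul_zero, pow_zero, mul_add, mul_one,
    pow_add, mul_comm (p ^ r)]

theorem odd_brk {p n : ℕ} (r : ℕ) (hp : Odd p) (hn : Odd n) : Odd (brk p r n) := by
  rw [brk, Finset.odd_sum_iff_odd_card_odd]
  simpa [hp.pow] using hn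

/-- The monomial map intertwines the skew shifts up to a scalar. -/
theorem psi_skewShift {K : Type} [CommRing K] (p r : ℕ) {n : ℕ} {ε lam mu : K}
    (h : lam = mu * ε ^ brk p r n) (c : Fin n → K) :
    psi p r ε (skewShift (fun a : K => a ^ p ^ r) lam c) =
      ε • skewShift (fun a : K => a ^ p ^ r) mu (psi p r ε c) := by
  funext ⟨i, hi⟩
  rcases i with _ | i
  · obtain ⟨m, rfl⟩ : ∃ m, n = m + 1 := ⟨n - 1, by omega⟩
    simp only [psi, skewShift, Pi.smul_apply, smul_eq_mul, h, if_true, brk_succ,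
      Nat.add_sub_cancel, mul_pow, ← pow_mul]
    simp only [brk, Finset.range_zero, Finset.sum_empty, pow_zero]
    ring
  · simp only [psi, skewShift, Pi.smul_apply, smul_eq_mul, Nat.succ_ne_zero, if_false, brk_succ,
      Nat.add_sub_cancel, mul_pow, ← pow_mul]
    ring

theorem psi_isLinearMap {K : Type} [CommRing K] (p r : ℕ) (ε : K) (n : ℕ) :
    IsLinearMap K (psi p r ε (n := n)) where
  map_add x y := by funext i; simp [psi, mul_add]
  map_smul a x := by funext i; simp [psi, mul_left_comm]

theorem psi_bijective {K : Type} [Field K] (p r : ℕ) {ε : K} (hε : ε ≠ 0) (n : ℕ) :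
    Function.Bijective (psi p r ε (n := n)) := by
  refine ⟨fun x y h => funext fun i => ?_,
    fun y => ⟨fun i => (ε ^ brk p r (i : ℕ))⁻¹ * y i, funext fun i => ?_⟩⟩
  · exact mul_left_cancel₀ (pow_ne_zero _ hε) (congrFun h i)
  · exact mul_inv_cancel_left₀ (pow_ne_zero _ hε) (y i)

theorem hammingNorm_psi {K : Type} [Field K] [DecidableEq K] (p r : ℕ) {ε : K} (hε : ε ≠ 0)
    {n : ℕ} (x : Fin n → K) : hammingNorm (psi p r ε x) = hammingNorm x := by
  simp [hammingNorm, psi, hε]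

/-- The monomial map carries skew constacyclic codes bijectively onto skew constacyclic codes
whose constants differ by the factor `ε ^ [n]`. -/
theorem psi_image_bijOn {K : Type} [Field K] (p r : ℕ) {n : ℕ} {ε lam mu : K} (hε : ε ≠ 0)
    (h : lam = mu * ε ^ brk p r n) :
    Set.BijOn (Set.image (psi p r ε))
      {S : Set (Fin n → K) | IsLinCode K S ∧ SkewConsta (fun a : K => a ^ p ^ r) lam S}
      {S : Set (Fin n → K) | IsLinCode K S ∧ SkewConsta (fun a : K => a ^ p ^ r) mu S} := by
  have hbij := psi_bijective p r hε n
  let f := (psi_isLinearMap p r ε n).mk'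
  refine ⟨?_, hbij.1.image_injective.injOn, ?_⟩
  · rintro _ ⟨⟨C, rfl⟩, hC⟩
    refine ⟨⟨C.map f, rfl⟩, ?_⟩
    rintro _ ⟨c, hc, rfl⟩
    refine ⟨ε⁻¹ • skewShift (fun a : K => a ^ p ^ r) lam c, C.smul_mem _ (hC c hc), ?_⟩
    rw [(psi_isLinearMap p r ε n).map_smul, psi_skewShift p r h, inv_smul_smul₀ hε]
  · rintro _ ⟨⟨C, rfl⟩, hC⟩
    refine ⟨psi p r ε ⁻¹' C, ⟨⟨C.comap f, rfl⟩, fun c hc => ?_⟩,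
      Set.image_preimage_eq _ hbij.2⟩
    rw [Set.mem_preimage, psi_skewShift p r h]
    exact C.smul_mem _ (hC _ hc)

/-- for `p` odd and `n` odd (a multiple of `t/r`), if `λ = δ^{[n]}`,
then the Hamming-weight-preserving `𝔽_q`-linear bijection `ψ_{-δ}` maps the set of skew
`λ`-constacyclic codes of length `n` bijectively onto the set of skew negacyclic codes. -/
theorem stmt7 (p t r n : ℕ) (hp : p.Prime) (hpodd : Odd p) (ht : 0 < t) (hr : r ∣ t)
    (hnodd : Odd n) (hn : (t / r) ∣ n)
    (F : Type) [Field F] [Fintype F] [DecidableEq F] (hF : Fintype.card F = p ^ t)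
    (lam δ : F) (hlam : lam ≠ 0) (hδ : δ ≠ 0) (hlamδ : lam = δ ^ brk p r n) :
    IsLinearMap F (psi p r (-δ) (n := n)) ∧
    Function.Bijective (psi p r (-δ) (n := n)) ∧
    (∀ x : Fin n → F, hammingNorm (psi p r (-δ) x) = hammingNorm x) ∧
    Set.BijOn (Set.image (psi p r (-δ)))
      {S : Set (Fin n → F) | IsLinCode F S ∧ SkewConsta (fun a : F => a ^ p ^ r) lam S}
      {S : Set (Fin n → F) | IsLinCode F S ∧
        SkewConsta (fun a : F => a ^ p ^ r) (-1 : F) S} := by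
  have hε : -δ ≠ 0 := neg_ne_zero.mpr hδ
  refine ⟨psi_isLinearMap p r _ n, psi_bijective p r hε n, hammingNorm_psi p r hε,
    psi_image_bijOn p r hε ?_⟩
  rw [hlamδ, (odd_brk r hpodd hnodd).neg_pow, neg_one_mul, neg_neg]
end

section
/- Assume t is even. For linear codes C₁, C₂ of length n over 𝔽_q, the linear code C = vC₁ ⊕ (1−v)C₂ over R is a Hermitian LCD code over R if and only if C₁ and C₂ are both Hermitian LCD codes of length n over 𝔽_q. -/
open scoped BigOperators

theorem mix_apply {F : Type} [Field F] {n : ℕ} (x y : Fin n → F) (i : Fin n) :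
    mix x y i = (y i, x i) := by
  simp [mix, vv, Prod.ext_iff]

theorem mix_eq_zero_iff {F : Type} [Field F] {n : ℕ} {x y : Fin n → F} :
    mix x y = 0 ↔ x = 0 ∧ y = 0 := by
  simp only [funext_iff, mix_apply, Pi.zero_apply, Prod.mk_eq_zero, forall_and]
  exact and_comm

theorem mixSet_eq_singleton_zero_iff {F : Type} [Field F] {n : ℕ} {A B : Set (Fin n → F)}
    (hA : 0 ∈ A) (hB : 0 ∈ B) : mixSet A B = {0} ↔ A = {0} ∧ B = {0} := by
  constructor
  · intro h
    have key : ∀ x ∈ A, ∀ y ∈ B, x = 0 ∧ y = 0 := fun x hx y hy =>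
      mix_eq_zero_iff.1 (h.subset ⟨x, hx, y, hy, rfl⟩)
    exact ⟨Set.eq_singleton_iff_unique_mem.2 ⟨hA, fun x hx => (key x hx 0 hB).1⟩,
      Set.eq_singleton_iff_unique_mem.2 ⟨hB, fun y hy => (key 0 hA y hy).2⟩⟩
  · rintro ⟨rfl, rfl⟩
    ext c
    simp [mixSet, mix_eq_zero_iff.2 ⟨rfl, rfl⟩]

/-- In characteristic `p`, the map `thR` is the componentwise `p ^ k`-th power. -/
theorem thR_prime_pow {F : Type} [Field F] (p k : ℕ) [ExpChar F p] (z : Rg F) :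
    thR F (p ^ k) z = (z.1 ^ p ^ k, z.2 ^ p ^ k) := by
  simp [thR, sub_pow_expChar_pow]

theorem mix_mem_dualH_mixSet_iff {F : Type} [Field F] (p k : ℕ) [ExpChar F p] {n : ℕ}
    {A B : Set (Fin n → F)} (hA : 0 ∈ A) (hB : 0 ∈ B) (x y : Fin n → F) :
    mix x y ∈ dualH (thR F (p ^ k)) (mixSet A B) ↔
      x ∈ dualH (fun a : F => a ^ p ^ k) A ∧ y ∈ dualH (fun a : F => a ^ p ^ k) B := by
  have key : ∀ a b : Fin n → F, ∑ i, mix x y i * thR F (p ^ k) (mix a b i) = 0 ↔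
      ∑ i, x i * a i ^ p ^ k = 0 ∧ ∑ i, y i * b i ^ p ^ k = 0 := fun a b => by
    simp only [thR_prime_pow, mix_apply, Prod.mk_mul_mk, Prod.ext_iff, Prod.fst_sum,
      Prod.snd_sum, Prod.fst_zero, Prod.snd_zero]
    exact and_comm
  constructor
  · intro h
    exact ⟨fun a ha => ((key a 0).1 (h _ ⟨a, ha, 0, hB, rfl⟩)).1,
      fun b hb => ((key 0 b).1 (h _ ⟨0, hA, b, hb, rfl⟩)).2⟩
  · rintro ⟨hx, hy⟩ _ ⟨a, ha, b, hb, rfl⟩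
    exact (key a b).2 ⟨hx a ha, hy b hb⟩

theorem mixSet_inter_dualH {F : Type} [Field F] (p k : ℕ) [ExpChar F p] {n : ℕ}
    {A B : Set (Fin n → F)} (hA : 0 ∈ A) (hB : 0 ∈ B) :
    mixSet A B ∩ dualH (thR F (p ^ k)) (mixSet A B) =
      mixSet (A ∩ dualH (fun a : F => a ^ p ^ k) A) (B ∩ dualH (fun a : F => a ^ p ^ k) B) := by
  ext c
  constructor
  · rintro ⟨⟨x, hx, y, hy, rfl⟩, h⟩
    obtain ⟨h₁, h₂⟩ := (mix_mem_dualH_mixSet_iff p k hA hB x y).1 h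
    exact ⟨x, ⟨hx, h₁⟩, y, ⟨hy, h₂⟩, rfl⟩
  · rintro ⟨x, ⟨hx, h₁⟩, y, ⟨hy, h₂⟩, rfl⟩
    exact ⟨⟨x, hx, y, hy, rfl⟩, (mix_mem_dualH_mixSet_iff p k hA hB x y).2 ⟨h₁, h₂⟩⟩

theorem zero_mem_dualH {K : Type} [CommRing K] (conj : K → K) {n : ℕ} (C : Set (Fin n → K)) :
    0 ∈ dualH conj C := fun y _ => by simp

/-- `t` even: `C = vC₁ ⊕ (1-v)C₂` is a Hermitian LCD code over `R` iff
`C₁` and `C₂` are Hermitian LCD codes over `𝔽_q`, where conjugation is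
`x ↦ x^{p^{t/2}}` on `F`, extended to `R` by `(a + vb)‾ = ā + v b̄`. -/
theorem stmt13 (p t n : ℕ) (hp : p.Prime) (ht : 0 < t) (hteven : 2 ∣ t)
    (F : Type) [Field F] [Fintype F] (hF : Fintype.card F = p ^ t)
    (C₁ C₂ : Submodule F (Fin n → F)) :
    mixSet (↑C₁ : Set (Fin n → F)) (↑C₂ : Set (Fin n → F)) ∩
        dualH (thR F (p ^ (t / 2)))
          (mixSet (↑C₁ : Set (Fin n → F)) (↑C₂ : Set (Fin n → F))) = {0} ↔
      (↑C₁ : Set (Fin n → F)) ∩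
          dualH (fun a : F => a ^ p ^ (t / 2)) (↑C₁ : Set (Fin n → F)) = {0} ∧
      (↑C₂ : Set (Fin n → F)) ∩
          dualH (fun a : F => a ^ p ^ (t / 2)) (↑C₂ : Set (Fin n → F)) = {0} := by
  have := Fact.mk hp
  have : CharP F p := charP_of_card_eq_prime_pow hF
  rw [mixSet_inter_dualH p (t / 2) C₁.zero_mem C₂.zero_mem]
  exact mixSet_eq_singleton_zero_iff ⟨C₁.zero_mem, zero_mem_dualH _ _⟩
    ⟨C₂.zero_mem, zero_mem_dualH _ _⟩
end
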